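/- Let G ∈ S⁰(𝔹ₙ), let (f_u)_{u≥0} be a normalized Loewner chain on 𝔹ₙ such that {e^{−u} f_u : u ≥ 0} is a normal family, and let φ_{s,t} = f_t⁻¹ ∘ f_s be its evolution family. Then for every 0 ≤ s ≤ t the map z ↦ e^{t−s}·G(φ_{s,t}(z)) belongs to S⁰(𝔹ₙ). -/

import Mathlib

open Metric Filter Set MeasureTheory

noncomputable section

/-- ℂⁿ with the Euclidean (Hermitian) norm. -/
abbrev En (n : ℕ) : Type := EuclideanSpace ℂ (Fin n)

/-- The open Euclidean unit ball 𝔹ₙ ⊂ ℂⁿ. -/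
def Ball (n : ℕ) : Set (En n) := Metric.ball 0 1

/-- A map is univalent on 𝔹ₙ if it is holomorphic and injective there. -/
def UnivalentOn (n : ℕ) (f : En n → En n) : Prop :=
  DifferentiableOn ℂ f (Ball n) ∧ Set.InjOn f (Ball n)

/-- The class S(𝔹ₙ): univalent maps with f(0) = 0 and Df(0) = I. -/
def ClassS (n : ℕ) (f : En n → En n) : Prop :=
  UnivalentOn n f ∧ f 0 = 0 ∧ fderiv ℂ f 0 = ContinuousLinearMap.id ℂ (En n)

/-- A Loewner chain on 𝔹ₙ: a family (f_t)_{t ≥ 0} of univalent maps with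
increasing images, locally absolutely continuous in t, uniformly on compacta. -/
def IsLoewnerChain (n : ℕ) (f : ℝ → En n → En n) : Prop :=
  (∀ t, 0 ≤ t → UnivalentOn n (f t)) ∧
  (∀ s t, 0 ≤ s → s ≤ t → f s '' Ball n ⊆ f t '' Ball n) ∧
  (∀ K : Set (En n), K ⊆ Ball n → IsCompact K → ∀ T : ℝ, 0 < T →
    ∃ c : ℝ → ℝ, (∀ τ, 0 ≤ c τ) ∧ IntegrableOn c (Set.Icc 0 T) ∧
      ∀ z ∈ K, ∀ s t : ℝ, 0 ≤ s → s ≤ t → t ≤ T →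
        ‖f s z - f t z‖ ≤ ∫ τ in Set.Icc s t, c τ)

/-- A normalized Loewner chain: f_t(0) = 0 and Df_t(0) = eᵗ·I for all t ≥ 0. -/
def IsNormalizedLoewnerChain (n : ℕ) (f : ℝ → En n → En n) : Prop :=
  IsLoewnerChain n f ∧ ∀ t, 0 ≤ t → f t 0 = 0 ∧
    fderiv ℂ (f t) 0 = (Real.exp t : ℂ) • ContinuousLinearMap.id ℂ (En n)

/-- The family {e^{−t} f_t : t ≥ 0} is a normal family, i.e. locally uniformly
bounded on 𝔹ₙ. -/
def IsNormalFamilyChain (n : ℕ) (f : ℝ → En n → En n) : Prop :=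
  ∀ K : Set (En n), K ⊆ Ball n → IsCompact K →
    ∃ M : ℝ, ∀ t, 0 ≤ t → ∀ z ∈ K, Real.exp (-t) * ‖f t z‖ ≤ M

/-- S⁰(𝔹ₙ): maps of S(𝔹ₙ) with parametric representation, i.e. the initial
element of a normalized Loewner chain (f_t) such that {e^{−t} f_t} is a normal
family. -/
def MemS0 (n : ℕ) (f : En n → En n) : Prop :=
  ClassS n f ∧ ∃ F : ℝ → En n → En n,
    IsNormalizedLoewnerChain n F ∧ IsNormalFamilyChain n F ∧ F 0 = f

/-- The evolution family φ_{s,t} = f_t⁻¹ ∘ f_s of a Loewner chain. -/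
def evolution (n : ℕ) (F : ℝ → En n → En n) (s t : ℝ) : En n → En n :=
  fun z => Function.invFunOn (F t) (Ball n) (F s z)


/-- Maximum principle for a continuous function on the closed disc, holomorphic off its zeros. -/
lemma max_princ (k : ℂ → ℂ) (hc : ContinuousOn k (closedBall 0 1))
    (hd : ∀ x ∈ ball (0:ℂ) 1, k x ≠ 0 → DifferentiableAt ℂ k x) (C : ℝ) (hC0 : 0 ≤ C)
    (hC : ∀ x ∈ sphere (0:ℂ) 1, ‖k x‖ ≤ C) : ‖k 0‖ ≤ C := by
  by_cases h0 : k 0 = 0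
  · simpa [h0] using hC0
  set U : Set ℂ := ball 0 1 ∩ k ⁻¹' {0}ᶜ with hU
  have hUo : IsOpen U := (hc.mono ball_subset_closedBall).isOpen_inter_preimage isOpen_ball
    isOpen_compl_singleton
  have hUb : Bornology.IsBounded U := isBounded_ball.subset inter_subset_left
  have hcl : closure U ⊆ closedBall 0 1 :=
    closure_minimal (inter_subset_left.trans ball_subset_closedBall) isClosed_closedBall
  refine Complex.norm_le_of_forall_mem_frontier_norm_le hUb ⟨?_, hc.mono hcl⟩ ?_
    (subset_closure (⟨by simp, h0⟩ : (0:ℂ) ∈ U))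
  · intro x hx
    exact (hd x hx.1 hx.2).differentiableWithinAt
  · intro z hz
    rw [hUo.frontier_eq] at hz
    have hz1 := hcl hz.1
    by_cases hs : z ∈ sphere (0:ℂ) 1
    · exact hC z hs
    · have hzb : z ∈ ball (0:ℂ) 1 := by
        simp at hz1 hs ⊢
        exact lt_of_le_of_ne hz1 hs
      have : k z = 0 := by
        by_contra h
        exact hz.2 ⟨hzb, h⟩
      simpa [this] using hC0

lemma rotation_zero (k : ℂ → ℂ) (hc : ContinuousOn k (closedBall 0 1))
    (hd : ∀ x ∈ ball (0:ℂ) 1, k x ≠ 0 → DifferentiableAt ℂ k x)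
    (h1 : ∀ᶠ x in nhds (1:ℂ), k x = 0) : k 0 = 0 := by
  obtain ⟨T, hT, hcov⟩ := (isCompact_sphere (0:ℂ) 1).elim_nhds_subcover
    (fun w => {x | k (w⁻¹ * x) = 0}) (fun w hw => by
      have hw0 : w ≠ 0 := by
        rintro rfl; simp at hw
      have : Tendsto (fun x => w⁻¹ * x) (nhds w) (nhds 1) := by
        have := (continuous_const_mul (w⁻¹)).tendsto w
        simpa [inv_mul_cancel₀ hw0] using this
      exact this.eventually h1)
  have hn : ∀ w ∈ T, ‖w⁻¹‖ = 1 := by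
    intro w hw
    have := hT w hw
    simp at this
    simp [this]
  have key : ‖∏ w ∈ T, k (w⁻¹ * 0)‖ ≤ 0 := by
    refine max_princ (fun x => ∏ w ∈ T, k (w⁻¹ * x)) ?_ ?_ 0 le_rfl ?_
    · refine continuousOn_finsetProd _ fun w hw => ?_
      refine hc.comp (by fun_prop) ?_
      intro x hx
      simp only [mem_closedBall_zero_iff, norm_mul, hn w hw] at hx ⊢
      simpa using hx
    · intro x hx hne
      rw [Finset.prod_ne_zero_iff] at hne
      refine DifferentiableAt.fun_finsetProd fun w hw => ?_
      have := hd (w⁻¹ * x) (by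
        simp only [mem_ball_zero_iff, norm_mul, hn w hw] at hx ⊢
        simpa using hx) (hne w hw)
      exact DifferentiableAt.comp x this (by fun_prop)
    · intro x hx
      obtain ⟨w, hw, hx'⟩ := mem_iUnion₂.1 (hcov hx)
      have hz : ∏ w ∈ T, k (w⁻¹ * x) = 0 := Finset.prod_eq_zero hw hx'
      rw [hz]; simp
  simp only [mul_zero, Finset.prod_const, norm_pow] at key
  have h2 : ‖k 0‖ ^ T.card = 0 := le_antisymm key (by positivity)
  exact norm_eq_zero.1 (eq_zero_of_pow_eq_zero h2)

lemma deriv_bound (p g : ℂ → ℂ) (hp : ContinuousOn p (closedBall 0 1))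
    (hg : ContinuousOn g (closedBall 0 1))
    (hd : ∀ x ∈ ball (0:ℂ) 1, g x ≠ 0 → DifferentiableAt ℂ g x)
    (hpd : ∀ x ∈ ball (0:ℂ) 1, g x ≠ 0 → DifferentiableAt ℂ p x) (h0 : g 0 ≠ 0)
    (M : ℝ) (hM0 : 0 < M) (hM : ∀ x ∈ closedBall (0:ℂ) 1, ‖p x‖ ≤ M) :
    ‖deriv p 0‖ ≤ 2 * M := by
  set U : Set ℂ := ball 0 1 ∩ g ⁻¹' {0}ᶜ with hU
  have hUo : IsOpen U := (hg.mono ball_subset_closedBall).isOpen_inter_preimage isOpen_ball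
    isOpen_compl_singleton
  have hU0 : (0:ℂ) ∈ U := ⟨by simp, h0⟩
  have hqd : DifferentiableOn ℂ (dslope p 0) U :=
    (Complex.differentiableOn_dslope (hUo.mem_nhds hU0)).2
      fun x hx => (hpd x hx.1 hx.2).differentiableWithinAt
  have hqc : ContinuousOn (dslope p 0) (closedBall 0 1) :=
    (continuousOn_dslope (closedBall_mem_nhds 0 one_pos)).2 ⟨hp, hpd 0 hU0.1 h0⟩
  obtain ⟨A, hA⟩ := (isCompact_closedBall (0:ℂ) 1).exists_bound_of_continuousOn hg
  have hA0 : 0 ≤ A := (norm_nonneg _).trans (hA 0 (by simp))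
  have hN : ∀ N : ℕ, ‖deriv p 0‖ ^ N * ‖g 0‖ ≤ (2 * M) ^ N * A := by
    intro N
    have := max_princ (fun x => dslope p 0 x ^ N * g x) ((hqc.pow N).mul hg) ?_
      ((2 * M) ^ N * A) (by positivity) ?_
    · simpa using this
    · intro x hx hne
      have hgx : g x ≠ 0 := right_ne_zero_of_mul hne
      exact ((hqd.differentiableAt (hUo.mem_nhds ⟨hx, hgx⟩)).pow N).mul (hd x hx hgx)
    · intro x hx
      have hx1 : ‖x‖ = 1 := by simpa using hx
      have hx0 : x ≠ 0 := by rintro rfl; simp at hx1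
      rw [norm_mul, norm_pow]
      have h2 : ‖dslope p 0 x‖ ≤ 2 * M := by
        rw [dslope_of_ne _ hx0, slope_def_field, norm_div, sub_zero, hx1, div_one]
        have h3 := hM x (sphere_subset_closedBall hx)
        have h4 := hM 0 (by simp)
        linarith [norm_sub_le (p x) (p 0)]
      have := hA x (sphere_subset_closedBall hx)
      gcongr
  by_contra hlt
  push Not at hlt
  have hg0 : 0 < ‖g 0‖ := norm_pos_iff.2 h0
  have h1 : 1 < ‖deriv p 0‖ / (2 * M) := by
    rw [one_lt_div (by positivity)]; exact hlt
  obtain ⟨N, hN'⟩ := pow_unbounded_of_one_lt (A / ‖g 0‖) h1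
  have := hN N
  rw [div_pow, div_lt_div_iff₀ hg0 (by positivity)] at hN'
  linarith

section generic

variable {E : Type*} [NormedAddCommGroup E] [NormedSpace ℂ E]

lemma not_ev_zero (c : E) (R : ℝ) (g : E → ℂ) (hg : ContinuousOn g (ball c R))
    (hd : ∀ w ∈ ball c R, g w ≠ 0 → DifferentiableAt ℂ g w)
    (w₁ : E) (hw₁ : w₁ ∈ ball c R) (h1 : g w₁ ≠ 0) :
    ∀ w ∈ ball c R, ¬ ∀ᶠ x in nhds w, g x = 0 := by
  intro w hw hev
  let _ : NormedSpace ℝ E := NormedSpace.restrictScalars ℝ ℂ E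
  have hpre : IsPreconnected (ball c R) := (convex_ball c R).isPreconnected
  have hA : ball c R ⊆ interior {x | g x = 0} := by
    refine hpre.subset_of_closure_inter_subset isOpen_interior
      ⟨w, hw, mem_interior_iff_mem_nhds.2 hev⟩ ?_
    rintro q ⟨hq, hqb⟩
    obtain ⟨δ, hδ, hsub⟩ := Metric.isOpen_iff.1 isOpen_ball q hqb
    obtain ⟨a, ha, haq⟩ := Metric.mem_closure_iff.1 hq (δ / 4) (by positivity)
    rw [mem_interior]
    refine ⟨ball q (δ / 4), ?_, isOpen_ball, mem_ball_self (by positivity)⟩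
    intro p hp
    have hpa : ‖a - p‖ < δ / 2 := by
      rw [← dist_eq_norm]
      rw [mem_ball] at hp
      rw [dist_comm] at haq
      linarith [dist_triangle a q p, dist_comm p q]
    have hin : ∀ x ∈ closedBall (0:ℂ) 1, p + x • (a - p) ∈ ball c R := by
      intro x hx
      apply hsub
      rw [mem_ball] at hp ⊢
      have h2 : dist (p + x • (a - p)) p ≤ ‖a - p‖ := by
        rw [dist_eq_norm, add_sub_cancel_left, norm_smul]
        exact mul_le_of_le_one_left (norm_nonneg _) (by simpa using hx)
      linarith [dist_triangle (p + x • (a - p)) p q]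
    have := rotation_zero (fun x => g (p + x • (a - p))) (hg.comp (by fun_prop) hin) ?_ ?_
    · simpa using this
    · intro x hx hne
      exact DifferentiableAt.comp x (hd _ (hin x (ball_subset_closedBall hx)) hne) (by fun_prop)
    · have ht : Tendsto (fun x : ℂ => p + x • (a - p)) (nhds 1) (nhds a) := by
        have : Continuous (fun x : ℂ => p + x • (a - p)) := by fun_prop
        simpa using this.tendsto 1
      exact ht.eventually (mem_interior_iff_mem_nhds.1 ha)
  have h2 : w₁ ∈ {x | g x = 0} := interior_subset (hA hw₁)
  exact h1 h2

lemma fderiv_apply_diff [FiniteDimensional ℂ E] {f : E → E} {U : Set E} (hU : IsOpen U)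
    (hf : DifferentiableOn ℂ f U) (z₀ : E) (hz₀ : z₀ ∈ U)
    (v : E) :
    DifferentiableAt ℂ (fun z => fderiv ℂ f z v) z₀ := by
  have : ProperSpace E := FiniteDimensional.proper ℂ E
  have : CompleteSpace E := FiniteDimensional.complete ℂ E
  borelize E
  obtain ⟨R', hR', hsub'⟩ := Metric.isOpen_iff.1 hU z₀ hz₀
  set R := R' / 4 with hR
  have hRpos : 0 < R := by positivity
  have hsub : closedBall z₀ (3 * R) ⊆ U := (closedBall_subset_ball (by linarith)).trans hsub'
  obtain ⟨M, hM⟩ := (isCompact_closedBall z₀ (3 * R)).exists_bound_of_continuousOn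
    (hf.continuousOn.mono hsub)
  obtain ⟨ρ, hρ, hρv⟩ : ∃ ρ : ℝ, 0 < ρ ∧ ρ * ‖v‖ < R := by
    refine ⟨R / (‖v‖ + 1), by positivity, ?_⟩
    rw [div_mul_eq_mul_div, div_lt_iff₀ (by positivity)]
    nlinarith [norm_nonneg v]
  have hball2 : ∀ z ∈ ball z₀ R, ∀ ζ ∈ closedBall (0:ℂ) ρ, z + ζ • v ∈ ball z₀ (2 * R) := by
    intro z hz ζ hζ
    rw [mem_ball] at hz ⊢
    have : dist (z + ζ • v) z < R := by
      rw [dist_eq_norm, add_sub_cancel_left, norm_smul]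
      refine lt_of_le_of_lt ?_ hρv
      have : ‖ζ‖ ≤ ρ := by simpa using hζ
      gcongr
    linarith [dist_triangle (z + ζ • v) z z₀]
  have hball3 : ball z₀ (2 * R) ⊆ U :=
    (ball_subset_closedBall.trans (closedBall_subset_closedBall (by linarith))).trans hsub
  have hdat : ∀ x ∈ ball z₀ (2 * R), DifferentiableAt ℂ f x := fun x hx =>
    hf.differentiableAt (hU.mem_nhds (hball3 hx))
  have hbd : ∀ x ∈ ball z₀ (2 * R), ‖fderiv ℂ f x‖ ≤ 2 * M / R := by
    intro x hx
    have hxs : ball x R ⊆ closedBall z₀ (3 * R) := by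
      intro y hy
      rw [mem_ball] at hx hy
      rw [mem_closedBall]
      linarith [dist_triangle y x z₀]
    refine Complex.norm_fderiv_le_div_of_mapsTo_ball (hf.mono (hxs.trans hsub)) ?_ hRpos
    intro y hy
    rw [mem_closedBall, dist_eq_norm]
    have h1 := hM y (hxs hy)
    have h2 := hM x (hxs (mem_ball_self hRpos))
    linarith [norm_sub_le (f y) (f x)]
  have hcm : ∀ θ, circleMap 0 ρ θ ∈ closedBall (0:ℂ) ρ := circleMap_mem_closedBall 0 hρ.le
  set a : ℝ → ℂ := fun θ => deriv (circleMap 0 ρ) θ * (1 / (circleMap 0 ρ θ - 0) ^ 2) with ha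
  have hac : Continuous a := by
    have h1 : ∀ θ, (circleMap 0 ρ θ - 0) ^ 2 ≠ 0 := by
      intro θ
      have := circleMap_ne_center (c := 0) (R := ρ) hρ.ne' (θ := θ)
      simpa using this
    simp only [ha, deriv_circleMap]
    refine ((continuous_circleMap 0 ρ).mul continuous_const).mul ?_
    refine Continuous.div continuous_const ?_ h1
    exact ((continuous_circleMap 0 ρ).sub continuous_const).pow 2
  have hint : ∀ z ∈ ball z₀ R,
      (2 * Real.pi * Complex.I) • fderiv ℂ f z v
        = ∫ θ in (0:ℝ)..2 * Real.pi, a θ • f (z + circleMap 0 ρ θ • v) := by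
    intro z hz
    have hline : DifferentiableOn ℂ (fun ζ : ℂ => f (z + ζ • v)) (closedBall 0 ρ) := by
      intro ζ hζ
      exact (DifferentiableAt.comp ζ (hdat _ (hball2 z hz ζ hζ)) (by fun_prop)).differentiableWithinAt
    have h1 := (hline.mono closure_ball_subset_closedBall).diffContOnCl.deriv_eq_smul_circleIntegral hρ
    have h2 : deriv (fun ζ : ℂ => f (z + ζ • v)) 0 = fderiv ℂ f z v := by
      have hz2 : DifferentiableAt ℂ f (z + (0:ℂ) • v) :=
        hdat _ (hball2 z hz 0 (by simp [hρ.le]))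
      have h3 : HasDerivAt (fun ζ : ℂ => z + ζ • v) v 0 := by
        simpa using ((hasDerivAt_id (0:ℂ)).smul_const v).const_add z
      have := (hz2.hasFDerivAt.comp_hasDerivAt (0:ℂ) h3).deriv
      simpa [Function.comp_def] using this
    rw [← h2, ← h1, circleIntegral]
    simp only [ha, smul_smul]
  have hmain : HasFDerivAt (fun z => ∫ θ in (0:ℝ)..2 * Real.pi, a θ • f (z + circleMap 0 ρ θ • v))
      (∫ θ in (0:ℝ)..2 * Real.pi, a θ • fderiv ℂ f (z₀ + circleMap 0 ρ θ • v)) z₀ := by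
    have hcont : ∀ x ∈ ball z₀ R, Continuous (fun θ => a θ • f (x + circleMap 0 ρ θ • v)) := by
      intro x hx
      refine hac.smul ?_
      rw [continuous_iff_continuousAt]
      intro θ
      refine ContinuousAt.comp (f := fun θ => x + circleMap 0 ρ θ • v)
        (hdat _ (hball2 x hx _ (hcm θ))).continuousAt ?_
      have := continuous_circleMap 0 ρ
      fun_prop
    refine intervalIntegral.hasFDerivAt_integral_of_dominated_of_fderiv_le
      (F' := fun x θ => a θ • fderiv ℂ f (x + circleMap 0 ρ θ • v))
      (bound := fun θ => ‖a θ‖ * (2 * M / R))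
      (ball_mem_nhds z₀ hRpos) ?_ ?_ ?_ ?_ ?_ ?_
    · filter_upwards [ball_mem_nhds z₀ hRpos] with x hx
      exact (hcont x hx).aestronglyMeasurable
    · exact (hcont z₀ (mem_ball_self hRpos)).intervalIntegrable _ _
    · refine hac.aestronglyMeasurable.smul ?_
      refine Measurable.aestronglyMeasurable ?_
      refine (measurable_fderiv ℂ f).comp ?_
      have := continuous_circleMap 0 ρ
      exact Continuous.measurable (by fun_prop)
    · refine Eventually.of_forall fun θ _ x hx => ?_
      rw [norm_smul]
      exact mul_le_mul_of_nonneg_left (hbd _ (hball2 x hx _ (hcm θ))) (norm_nonneg _)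
    · exact (hac.norm.mul continuous_const).intervalIntegrable _ _
    · refine Eventually.of_forall fun θ _ x hx => ?_
      have h3 := (hdat _ (hball2 x hx _ (hcm θ))).hasFDerivAt
      have h4 : HasFDerivAt (fun x => x + circleMap 0 ρ θ • v) (ContinuousLinearMap.id ℂ _) x :=
        (hasFDerivAt_id x).add_const _
      exact (h3.comp x h4).const_smul (a θ)
  have h2pi : (2 * Real.pi * Complex.I : ℂ) ≠ 0 := Complex.two_pi_I_ne_zero
  refine (hmain.differentiableAt.const_smul ((2 * Real.pi * Complex.I : ℂ)⁻¹)).congr_of_eventuallyEq ?_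
  filter_upwards [ball_mem_nhds z₀ hRpos] with z hz
  simp only [Pi.smul_apply]
  rw [← hint z hz, smul_smul, inv_mul_cancel₀ h2pi, one_smul]

lemma fderiv_contOn {n : ℕ} {f : EuclideanSpace ℂ (Fin n) → EuclideanSpace ℂ (Fin n)}
    {U : Set (EuclideanSpace ℂ (Fin n))} (hU : IsOpen U)
    (hf : DifferentiableOn ℂ f U) : ContinuousOn (fderiv ℂ f) U :=
  continuousOn_clm_apply.2 fun v z hz =>
    (fderiv_apply_diff hU hf z hz v).continuousAt.continuousWithinAt

lemma strict_of_diff {n : ℕ} {f : EuclideanSpace ℂ (Fin n) → EuclideanSpace ℂ (Fin n)}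
    {U : Set (EuclideanSpace ℂ (Fin n))} (hU : IsOpen U)
    (hf : DifferentiableOn ℂ f U) {z : EuclideanSpace ℂ (Fin n)} (hz : z ∈ U) :
    HasStrictFDerivAt f (fderiv ℂ f z) z := by
  refine hasStrictFDerivAt_of_hasFDerivAt_of_continuousAt ?_
    ((fderiv_contOn hU hf).continuousAt (hU.mem_nhds hz))
  filter_upwards [hU.mem_nhds hz] with y hy
  exact (hf.differentiableAt (hU.mem_nhds hy)).hasFDerivAt

/-- The complex Jacobian determinant. -/
noncomputable def cjac {n : ℕ} (f : EuclideanSpace ℂ (Fin n) → EuclideanSpace ℂ (Fin n))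
    (z : EuclideanSpace ℂ (Fin n)) : ℂ :=
  LinearMap.det (fderiv ℂ f z : EuclideanSpace ℂ (Fin n) →ₗ[ℂ] EuclideanSpace ℂ (Fin n))

lemma cjac_diff {n : ℕ} {f : EuclideanSpace ℂ (Fin n) → EuclideanSpace ℂ (Fin n)}
    {U : Set (EuclideanSpace ℂ (Fin n))} (hU : IsOpen U)
    (hf : DifferentiableOn ℂ f U) : DifferentiableOn ℂ (cjac f) U := by
  intro z hz
  refine DifferentiableAt.differentiableWithinAt ?_
  have h : cjac f = fun z => Matrix.det (fun i j =>
      (fderiv ℂ f z ((EuclideanSpace.basisFun (Fin n) ℂ) j)) i) := by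
    funext z
    rw [cjac, ← LinearMap.det_toMatrix (EuclideanSpace.basisFun (Fin n) ℂ).toBasis]
    congr 1
    ext i j
    simp [LinearMap.toMatrix_apply]
  rw [h]
  have h' : (fun z => Matrix.det (fun i j =>
      (fderiv ℂ f z ((EuclideanSpace.basisFun (Fin n) ℂ) j)) i)) = fun z =>
      ∑ σ : Equiv.Perm (Fin n), ((Equiv.Perm.sign σ : ℤ) : ℂ) * ∏ i,
        (fderiv ℂ f z ((EuclideanSpace.basisFun (Fin n) ℂ) i)) (σ i) := by
    funext z
    exact Matrix.det_apply' _
  rw [h']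
  apply DifferentiableAt.fun_sum
  intro σ _
  apply DifferentiableAt.const_mul
  have hi : ∀ i, DifferentiableAt ℂ (fun y =>
      ((fderiv ℂ f y) ((EuclideanSpace.basisFun (Fin n) ℂ) i)) (σ i)) z := by
    intro i
    have := fderiv_apply_diff hU hf z hz ((EuclideanSpace.basisFun (Fin n) ℂ) i)
    exact (differentiableAt_euclidean.1 this) _
  exact (HasFDerivAt.finsetProd fun i _ => (hi i).hasFDerivAt).differentiableAt

lemma cjac_ne {n : ℕ} {f : EuclideanSpace ℂ (Fin n) → EuclideanSpace ℂ (Fin n)}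
    {z : EuclideanSpace ℂ (Fin n)} (h : cjac f z ≠ 0) :
    ∃ e : EuclideanSpace ℂ (Fin n) ≃L[ℂ] EuclideanSpace ℂ (Fin n),
      (e : EuclideanSpace ℂ (Fin n) →L[ℂ] EuclideanSpace ℂ (Fin n)) = fderiv ℂ f z := by
  exact ⟨(fderiv ℂ f z).toContinuousLinearEquivOfDetNeZero h, by
    ext1 x; exact ContinuousLinearMap.toContinuousLinearEquivOfDetNeZero_apply _ h x⟩

lemma cjac_eq_zero {n : ℕ} {f : EuclideanSpace ℂ (Fin n) → EuclideanSpace ℂ (Fin n)}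
    {z : EuclideanSpace ℂ (Fin n)} (h : cjac f z = 0) :
    ∃ v, v ≠ 0 ∧ fderiv ℂ f z v = 0 := by
  have := LinearMap.bot_lt_ker_of_det_eq_zero h
  obtain ⟨v, hv, hv0⟩ := (Submodule.ne_bot_iff _).1 this.ne'
  exact ⟨v, hv0, hv⟩

/-- Key step of Osgood's theorem: an injective holomorphic map whose Jacobian does not vanish
identically near any point is locally biholomorphic. -/
lemma osgood_aux [FiniteDimensional ℂ E] {U : Set E} (hU : IsOpen U) (f : E → E) (J : E → ℂ)
    (hJ : DifferentiableOn ℂ J U) (hinj : InjOn f U)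
    (hstr : ∀ z ∈ U, HasStrictFDerivAt f (fderiv ℂ f z) z)
    (hcont : ContinuousOn (fderiv ℂ f) U)
    (hJne : ∀ z, J z ≠ 0 → ∃ e : E ≃L[ℂ] E, (e : E →L[ℂ] E) = fderiv ℂ f z)
    (hJz : ∀ z, J z = 0 → ∃ v, v ≠ 0 ∧ fderiv ℂ f z v = 0)
    (hev : ∀ z ∈ U, ¬ ∀ᶠ x in nhds z, J x = 0) :
    ∀ z ∈ U, J z ≠ 0 := by
  have : ProperSpace E := FiniteDimensional.proper ℂ E
  have : CompleteSpace E := FiniteDimensional.complete ℂ E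
  intro z₀ hz₀ hz0
  obtain ⟨r', hr', hsub'⟩ := Metric.isOpen_iff.1 hU z₀ hz₀
  set r := r' / 2 with hr
  have hrpos : 0 < r := by positivity
  have hKU : closedBall z₀ r ⊆ U := (closedBall_subset_ball (by linarith)).trans hsub'
  have hfc : ContinuousOn f U := fun z hz => (hstr z hz).continuousAt.continuousWithinAt
  have hinjK : InjOn f (closedBall z₀ r) := hinj.mono hKU
  have hKc : IsCompact (closedBall z₀ r) := isCompact_closedBall z₀ r
  -- a lower bound on the sphere
  obtain ⟨ε, hε, hεs⟩ : ∃ ε > 0, ∀ z ∈ sphere z₀ r, ε ≤ dist (f z) (f z₀) := by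
    rcases (sphere z₀ r).eq_empty_or_nonempty with h | h
    · exact ⟨1, one_pos, by simp [h]⟩
    · obtain ⟨y, hy, hmin⟩ := (isCompact_sphere z₀ r).exists_isMinOn h
        (f := fun z => dist (f z) (f z₀))
        ((continuous_id.dist continuous_const).comp_continuousOn
          (hfc.mono (sphere_subset_closedBall.trans hKU)))
      refine ⟨dist (f y) (f z₀), ?_, fun z hz => hmin hz⟩
      refine dist_pos.2 ?_
      intro he
      have := hinj (hKU (sphere_subset_closedBall hy)) hz₀ he
      subst this
      simp at hy
      exact hrpos.ne hy
  set W := f '' closedBall z₀ r with hW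
  have hWc : IsCompact W := hKc.image_of_continuousOn (hfc.mono hKU)
  set ψ := Function.invFunOn f (closedBall z₀ r) with hψ
  have hψf : ∀ z ∈ closedBall z₀ r, ψ (f z) = z := fun z hz => hinjK.leftInvOn_invFunOn hz
  have hψK : ∀ w ∈ W, ψ w ∈ closedBall z₀ r := fun w hw => Function.invFunOn_mem hw
  have hfψ : ∀ w ∈ W, f (ψ w) = w := fun w hw => Function.invFunOn_eq hw
  have hball : ∀ w ∈ W, w ∈ ball (f z₀) ε → ψ w ∈ ball z₀ r := by
    intro w hw hwb
    have h1 := hψK w hw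
    by_contra h2
    have h3 : ψ w ∈ sphere z₀ r := by
      rw [mem_closedBall] at h1
      rw [mem_ball, not_lt] at h2
      exact le_antisymm h1 h2
    have := hεs _ h3
    rw [hfψ w hw] at this
    exact absurd hwb (by simpa using this)
  have hψc : ContinuousOn ψ W := by
    rw [continuousOn_iff_isClosed]
    intro t ht
    refine ⟨f '' (closedBall z₀ r ∩ t), ((hKc.inter_right ht).image_of_continuousOn
      (hfc.mono (inter_subset_left.trans hKU))).isClosed, ?_⟩
    ext w
    constructor
    · rintro ⟨hw1, hw2⟩
      exact ⟨⟨ψ w, ⟨hψK w hw2, hw1⟩, hfψ w hw2⟩, hw2⟩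
    · rintro ⟨⟨z, ⟨hz1, hz2⟩, rfl⟩, hw2⟩
      refine ⟨?_, hw2⟩
      rw [mem_preimage, hψf z hz1]
      exact hz2
  -- local inverse
  have hloc : ∀ w ∈ W, w ∈ ball (f z₀) ε → J (ψ w) ≠ 0 →
      ∃ e : E ≃L[ℂ] E, (e : E →L[ℂ] E) = fderiv ℂ f (ψ w) ∧
        HasStrictFDerivAt ψ (e.symm : E →L[ℂ] E) w ∧ W ∈ nhds w := by
    intro w hw hwb hne
    obtain ⟨e, he⟩ := hJne _ hne
    have h1 := hstr _ (hKU (hψK w hw))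
    rw [← he] at h1
    have hn : closedBall z₀ r ∈ nhds (ψ w) :=
      mem_of_superset (isOpen_ball.mem_nhds (hball w hw hwb)) ball_subset_closedBall
    have h2 := h1.to_local_left_inverse (g := ψ) (by
      filter_upwards [hn] with z hz using hψf z hz)
    have h3 := h1.map_nhds_eq_of_equiv
    rw [hfψ w hw] at h2 h3
    refine ⟨e, he, h2, ?_⟩
    rw [← h3]
    exact image_mem_map hn
  classical
  set g : E → ℂ := fun w => if w ∈ W then J (ψ w) else 0 with hg
  have hgW : ∀ w ∈ W, g w = J (ψ w) := fun w hw => if_pos hw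
  have hgn : ∀ w, w ∉ W → g w = 0 := fun w hw => if_neg hw
  have hgd : ∀ w ∈ ball (f z₀) ε, g w ≠ 0 → DifferentiableAt ℂ g w := by
    intro w hw hne
    have hwW : w ∈ W := by
      by_contra h
      exact hne (hgn w h)
    rw [hgW w hwW] at hne
    obtain ⟨e, he, h1, h2⟩ := hloc w hwW hw hne
    have h3 : DifferentiableAt ℂ (fun w => J (ψ w)) w :=
      DifferentiableAt.comp w (hJ.differentiableAt (hU.mem_nhds (hKU (hψK w hwW))))
        h1.hasFDerivAt.differentiableAt
    refine h3.congr_of_eventuallyEq ?_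
    filter_upwards [h2] with x hx using hgW x hx
  have hJψ : ContinuousOn (fun w => J (ψ w)) W :=
    hJ.continuousOn.comp hψc fun w hw => hKU (hψK w hw)
  have hgc : ContinuousOn g (ball (f z₀) ε) := by
    intro w hw
    refine ContinuousAt.continuousWithinAt ?_
    by_cases hwW : w ∈ W
    · by_cases hne : g w = 0
      · rw [Metric.continuousAt_iff]
        intro δ hδ
        have h1 := Metric.continuousWithinAt_iff.1 (hJψ w hwW) δ hδ
        obtain ⟨η, hη, h1⟩ := h1
        refine ⟨η, hη, fun x hx => ?_⟩
        by_cases hxW : x ∈ W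
        · rw [hgW x hxW, hgW w hwW]
          exact h1 hxW hx
        · rw [hgn x hxW, hne]; simpa using hδ
      · exact (hgd w hw hne).continuousAt
    · have : g =ᶠ[nhds w] fun _ => 0 := by
        filter_upwards [hWc.isClosed.isOpen_compl.mem_nhds hwW] with x hx using hgn x hx
      exact continuousAt_const.congr this.symm
  have hnb : ∀ᶠ z in nhds z₀, z ∈ closedBall z₀ r ∧ f z ∈ ball (f z₀) (ε / 2) :=
    Filter.Eventually.and (closedBall_mem_nhds z₀ hrpos)
      ((hstr z₀ hz₀).continuousAt (ball_mem_nhds _ (by positivity)))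
  have hfreq : ∃ᶠ z in nhds z₀, J z ≠ 0 := by
    unfold Filter.Frequently
    simpa only [not_not] using hev z₀ hz₀
  have hsm : ball (f z₀) (ε / 2) ⊆ ball (f z₀) ε := ball_subset_ball (by linarith)
  obtain ⟨z₁, hz₁, hz₁K, hz₁b⟩ := (hfreq.and_eventually hnb).exists
  have hne := not_ev_zero (f z₀) ε g hgc hgd (f z₁) (hsm hz₁b) (by
    rw [hgW _ (mem_image_of_mem f hz₁K), hψf _ hz₁K]; exact hz₁)
  have hDW : ball (f z₀) ε ⊆ W := by
    intro w hw
    by_contra hwW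
    refine hne w hw ?_
    filter_upwards [hWc.isClosed.isOpen_compl.mem_nhds hwW] with x hx using hgn x hx
  -- derivative estimate
  obtain ⟨v', hv', hv'0⟩ := hJz z₀ hz0
  obtain ⟨v, hv, hv0⟩ : ∃ v, ‖v‖ = 2 * r + 1 ∧ fderiv ℂ f z₀ v = 0 := by
    refine ⟨((((2 * r + 1) / ‖v'‖ : ℝ)) : ℂ) • v', ?_, by rw [map_smul, hv'0, smul_zero]⟩
    have : ‖v'‖ ≠ 0 := norm_ne_zero_iff.2 hv'
    rw [norm_smul, Complex.norm_real, Real.norm_of_nonneg (by positivity)]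
    field_simp
  have hsmall : ∀ᶠ z in nhds z₀, ‖fderiv ℂ f z v‖ < ε / 4 := by
    have h1 : ContinuousAt (fun z => ‖fderiv ℂ f z v‖) z₀ :=
      ((hcont.continuousAt (hU.mem_nhds hz₀)).clm_apply continuousAt_const).norm
    refine h1.eventually_lt_const ?_
    simp only [hv0, norm_zero]; positivity
  obtain ⟨z, hzJ, ⟨hzK, hzb⟩, hzs⟩ := (hfreq.and_eventually (hnb.and hsmall)).exists
  have hzW : f z ∈ W := mem_image_of_mem f hzK
  have hψz := hψf z hzK
  obtain ⟨e, he, h1, -⟩ := hloc (f z) hzW (hsm hzb) (by rw [hψz]; exact hzJ)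
  rw [hψz] at he
  set u := fderiv ℂ f z v with hu
  have heu : e.symm u = v := by
    rw [ContinuousLinearEquiv.symm_apply_eq, hu, ← he]; rfl
  have hin : ∀ x ∈ closedBall (0:ℂ) 1, f z + x • u ∈ ball (f z₀) ε := by
    intro x hx
    rw [mem_ball] at hzb ⊢
    have h2 : dist (f z + x • u) (f z) ≤ ‖u‖ := by
      rw [dist_eq_norm, add_sub_cancel_left, norm_smul]
      exact mul_le_of_le_one_left (norm_nonneg _) (by simpa using hx)
    linarith [dist_triangle (f z + x • u) (f z) (f z₀)]
  obtain ⟨l, hl, hlv⟩ := exists_dual_vector'' ℂ v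
  have hline : Continuous fun x : ℂ => f z + x • u := by fun_prop
  have hbound := deriv_bound (fun x => l (ψ (f z + x • u) - z₀)) (fun x => g (f z + x • u))
    (l.continuous.comp_continuousOn
      (((hψc.mono hDW).comp hline.continuousOn hin).sub continuousOn_const))
    (hgc.comp hline.continuousOn hin)
    (fun x hx hne => DifferentiableAt.comp x (hgd _ (hin x (ball_subset_closedBall hx)) hne)
      (by fun_prop))
    (fun x hx hne => by
      have hxb := hin x (ball_subset_closedBall hx)
      rw [hgW _ (hDW hxb)] at hne
      obtain ⟨e', -, h2, -⟩ := hloc _ (hDW hxb) hxb hne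
      have h3 : DifferentiableAt ℂ (fun x : ℂ => ψ (f z + x • u)) x :=
        h2.hasFDerivAt.differentiableAt.comp (f := fun x : ℂ => f z + x • u) x (by fun_prop)
      exact l.differentiableAt.comp x (h3.sub_const z₀))
    (by
      simp only [zero_smul, add_zero]
      rw [hgW _ hzW, hψz]; exact hzJ)
    r hrpos
    (fun x hx => by
      have h2 := hψK _ (hDW (hin x hx))
      rw [mem_closedBall, dist_eq_norm] at h2
      calc ‖l (ψ (f z + x • u) - z₀)‖ ≤ ‖l‖ * ‖ψ (f z + x • u) - z₀‖ := l.le_opNorm _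
        _ ≤ 1 * r := by gcongr
        _ = r := one_mul r)
  have hder : HasDerivAt (fun x : ℂ => l (ψ (f z + x • u) - z₀)) (l v) 0 := by
    have h3 : HasDerivAt (fun x : ℂ => f z + x • u) u 0 := by
      simpa using ((hasDerivAt_id (0:ℂ)).smul_const u).const_add (f z)
    have h1' : HasFDerivAt ψ (e.symm : E →L[ℂ] E) (f z + (0:ℂ) • u) := by
      simpa using h1.hasFDerivAt
    have h4 := (h1'.comp_hasDerivAt (0:ℂ) h3).sub_const z₀
    have h5 := l.hasFDerivAt.comp_hasDerivAt (0:ℂ) h4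
    rw [← heu]
    exact h5
  rw [hder.deriv, hlv] at hbound
  simp only [Complex.norm_real, norm_norm, Complex.coe_algebraMap] at hbound
  have : ‖v‖ ≤ 2 * r := by simpa using hbound
  linarith

end generic

lemma ball_isOpen (n : ℕ) : IsOpen (Ball n) := isOpen_ball

lemma zero_mem_Ball (n : ℕ) : (0 : En n) ∈ Ball n := mem_ball_self one_pos

/-- A univalent map with a normalized derivative at the origin has a holomorphic inverse. -/
lemma inv_facts {n : ℕ} {f : En n → En n} (hf : UnivalentOn n f) {c : ℂ} (hc : c ≠ 0)
    (h0 : fderiv ℂ f 0 = c • ContinuousLinearMap.id ℂ (En n)) {z : En n} (hz : z ∈ Ball n) :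
    ∃ e : En n ≃L[ℂ] En n, (e : En n →L[ℂ] En n) = fderiv ℂ f z ∧
      HasStrictFDerivAt (Function.invFunOn f (Ball n)) (e.symm : En n →L[ℂ] En n) (f z) := by
  have hB := ball_isOpen n
  have hJ := cjac_diff hB hf.1
  have hJ0 : cjac f 0 ≠ 0 := by
    rw [cjac, h0]
    have : ((c • ContinuousLinearMap.id ℂ (En n) : En n →L[ℂ] En n) : En n →ₗ[ℂ] En n)
        = c • LinearMap.id := rfl
    rw [this, LinearMap.det_smul, LinearMap.det_id, mul_one]
    exact pow_ne_zero _ hc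
  have hev : ∀ z ∈ Ball n, ¬ ∀ᶠ x in nhds z, cjac f x = 0 :=
    not_ev_zero (0 : En n) 1 (cjac f) hJ.continuousOn
      (fun w hw _ => hJ.differentiableAt (hB.mem_nhds hw)) 0 (zero_mem_Ball n) hJ0
  have hne := osgood_aux hB f (cjac f) hJ hf.2 (fun z hz => strict_of_diff hB hf.1 hz)
    (fderiv_contOn hB hf.1) (fun z h => cjac_ne h) (fun z h => cjac_eq_zero h) hev z hz
  obtain ⟨e, he⟩ := cjac_ne hne
  refine ⟨e, he, ?_⟩
  have h1 := strict_of_diff hB hf.1 hz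
  rw [← he] at h1
  refine h1.to_local_left_inverse ?_
  filter_upwards [hB.mem_nhds hz] with x hx using hf.2.leftInvOn_invFunOn hx

lemma evol_mem {n : ℕ} {F : ℝ → En n → En n} (hF : IsNormalizedLoewnerChain n F)
    {s t : ℝ} (hs : 0 ≤ s) (hst : s ≤ t) {z : En n} (hz : z ∈ Ball n) : evolution n F s t z ∈ Ball n :=
  Function.invFunOn_mem (hF.1.2.1 s t hs hst (mem_image_of_mem _ hz))

lemma evol_eq {n : ℕ} {F : ℝ → En n → En n} (hF : IsNormalizedLoewnerChain n F)
    {s t : ℝ} (hs : 0 ≤ s) (hst : s ≤ t) {z : En n} (hz : z ∈ Ball n) : F t (evolution n F s t z) = F s z :=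
  Function.invFunOn_eq (hF.1.2.1 s t hs hst (mem_image_of_mem _ hz))

lemma evol_strict {n : ℕ} {F : ℝ → En n → En n} (hF : IsNormalizedLoewnerChain n F)
    {s t : ℝ} (hs : 0 ≤ s) (hst : s ≤ t) {z : En n} (hz : z ∈ Ball n) :
    ∃ e : En n ≃L[ℂ] En n, (e : En n →L[ℂ] En n) = fderiv ℂ (F t) (evolution n F s t z) ∧
      HasStrictFDerivAt (Function.invFunOn (F t) (Ball n)) (e.symm : En n →L[ℂ] En n) (F s z) := by
  have ht := hs.trans hst
  have := inv_facts (hF.1.1 t ht) (c := (Real.exp t : ℂ))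
    (by exact_mod_cast (Real.exp_pos t).ne') (hF.2 t ht).2 (evol_mem hF hs hst hz)
  rwa [evol_eq hF hs hst hz] at this

lemma evol_diff {n : ℕ} {F : ℝ → En n → En n} (hF : IsNormalizedLoewnerChain n F)
    {s t : ℝ} (hs : 0 ≤ s) (hst : s ≤ t) : DifferentiableOn ℂ (evolution n F s t) (Ball n) := by
  intro z hz
  obtain ⟨e, -, he⟩ := evol_strict hF hs hst hz
  have h1 := (hF.1.1 s hs).1.differentiableAt ((ball_isOpen n).mem_nhds hz)
  exact (he.hasFDerivAt.differentiableAt.comp z h1).differentiableWithinAt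

lemma evol_zero {n : ℕ} {F : ℝ → En n → En n} (hF : IsNormalizedLoewnerChain n F)
    {s t : ℝ} (hs : 0 ≤ s) (hst : s ≤ t) : evolution n F s t 0 = 0 := by
  have ht := hs.trans hst
  refine (hF.1.1 t ht).2 (evol_mem hF hs hst (zero_mem_Ball n)) (zero_mem_Ball n) ?_
  rw [evol_eq hF hs hst (zero_mem_Ball n), (hF.2 s hs).1, (hF.2 t ht).1]

lemma evol_norm {n : ℕ} {F : ℝ → En n → En n} (hF : IsNormalizedLoewnerChain n F)
    {s t : ℝ} (hs : 0 ≤ s) (hst : s ≤ t) {z : En n} (hz : z ∈ Ball n) : ‖evolution n F s t z‖ ≤ ‖z‖ := by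
  refine Complex.norm_le_norm_of_mapsTo_ball (R := 1) (evol_diff hF hs hst) ?_
    (evol_zero hF hs hst) (by simpa [Ball] using hz)
  intro x hx
  exact ball_subset_closedBall (evol_mem hF hs hst hx)

lemma evol_inj {n : ℕ} {F : ℝ → En n → En n} (hF : IsNormalizedLoewnerChain n F)
    {s t : ℝ} (hs : 0 ≤ s) (hst : s ≤ t) : InjOn (evolution n F s t) (Ball n) := by
  intro x hx y hy hxy
  refine (hF.1.1 s hs).2 hx hy ?_
  rw [← evol_eq hF hs hst hx, hxy, evol_eq hF hs hst hy]

lemma evol_hasFDeriv {n : ℕ} {F : ℝ → En n → En n} (hF : IsNormalizedLoewnerChain n F)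
    {s t : ℝ} (hs : 0 ≤ s) (hst : s ≤ t) : HasFDerivAt (evolution n F s t)
    ((Real.exp (s - t) : ℂ) • ContinuousLinearMap.id ℂ (En n)) 0 := by
  have ht := hs.trans hst
  have h0 := zero_mem_Ball n
  have hd := ((evol_diff hF hs hst).differentiableAt ((ball_isOpen n).mem_nhds h0)).hasFDerivAt
  have h1 : HasFDerivAt (F t) ((Real.exp t : ℂ) • ContinuousLinearMap.id ℂ (En n))
      (evolution n F s t 0) := by
    rw [evol_zero hF hs hst, ← (hF.2 t ht).2]
    exact ((hF.1.1 t ht).1.differentiableAt ((ball_isOpen n).mem_nhds h0)).hasFDerivAt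
  have h2 : HasFDerivAt (F s) ((Real.exp s : ℂ) • ContinuousLinearMap.id ℂ (En n)) 0 := by
    rw [← (hF.2 s hs).2]
    exact ((hF.1.1 s hs).1.differentiableAt ((ball_isOpen n).mem_nhds h0)).hasFDerivAt
  have h3 := (h1.comp 0 hd).congr_of_eventuallyEq (f₁ := F s) (by
    filter_upwards [(ball_isOpen n).mem_nhds h0] with x hx
    exact (evol_eq hF hs hst hx).symm)
  have h4 := h3.unique h2
  have h5 : fderiv ℂ (evolution n F s t) 0
      = (Real.exp (s - t) : ℂ) • ContinuousLinearMap.id ℂ (En n) := by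
    ext1 v
    have h6 := congrArg (fun A : En n →L[ℂ] En n => A v) h4
    simp only [ContinuousLinearMap.comp_apply, ContinuousLinearMap.smul_apply,
      ContinuousLinearMap.id_apply] at h6 ⊢
    have ht0 : (Real.exp t : ℂ) ≠ 0 := by exact_mod_cast (Real.exp_pos t).ne'
    rw [Real.exp_sub, Complex.ofReal_div, div_eq_inv_mul, mul_smul, ← h6, smul_smul,
      inv_mul_cancel₀ ht0, one_smul]
  rwa [h5] at hd


lemma compact_sub {n : ℕ} {K : Set (En n)} (hK : K ⊆ Ball n) (hKc : IsCompact K) :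
    ∃ r : ℝ, r < 1 ∧ ∀ z ∈ K, ‖z‖ ≤ r := by
  rcases K.eq_empty_or_nonempty with rfl | hne
  · exact ⟨0, one_pos, by simp⟩
  · obtain ⟨y, hy, hmax⟩ := hKc.exists_isMaxOn hne continuous_norm.continuousOn
    exact ⟨‖y‖, by simpa [Ball] using hK hy, fun z hz => hmax hz⟩

lemma shift_int (d : ℝ → ℝ) (u v h : ℝ) (huv : u ≤ v) :
    ∫ τ in Icc u v, d (τ + h) = ∫ τ in Icc (u + h) (v + h), d τ := by
  rw [integral_Icc_eq_integral_Ioc, integral_Icc_eq_integral_Ioc,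
    ← intervalIntegral.integral_of_le huv, ← intervalIntegral.integral_of_le (by linarith),
    intervalIntegral.integral_comp_add_right]

lemma indicator_int (d : ℝ → ℝ) (u v T : ℝ) (hu : 0 ≤ u) (hv : v ≤ T) :
    ∫ τ in Icc u v, (Icc 0 T).indicator d τ = ∫ τ in Icc u v, d τ := by
  refine setIntegral_congr_fun measurableSet_Icc fun τ hτ => ?_
  have hm : τ ∈ Icc (0:ℝ) T := ⟨hu.trans hτ.1, hτ.2.trans hv⟩
  exact Set.indicator_of_mem hm d

/-- If G ∈ S⁰(𝔹ₙ) and φ_{s,t} is the evolution family of a normalized Loewner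
chain whose normalization {e^{−u} f_u} is a normal family, then
z ↦ e^{t−s}·G(φ_{s,t}(z)) belongs to S⁰(𝔹ₙ). -/
theorem memS0_exp_smul_comp_evolution (n : ℕ) (F : ℝ → En n → En n)
    (hF : IsNormalizedLoewnerChain n F) (hN : IsNormalFamilyChain n F)
    (G : En n → En n) (hG : MemS0 n G)
    (s t : ℝ) (hs : 0 ≤ s) (hst : s ≤ t) :
    MemS0 n (fun z => (Real.exp (t - s) : ℂ) • G (evolution n F s t z)) := by
  have ht : 0 ≤ t := hs.trans hst
  obtain ⟨hGS, Gc, hGc, hGN, hG0⟩ := hG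
  set a := t - s with ha
  have ha0 : 0 ≤ a := by rw [ha]; linarith
  have hea : (Real.exp a : ℂ) ≠ 0 := by exact_mod_cast (Real.exp_pos a).ne'
  have hnea : ‖(Real.exp a : ℂ)‖ = Real.exp a := by
    rw [Complex.norm_real, Real.norm_of_nonneg (Real.exp_pos a).le]
  have hB := ball_isOpen n
  set H : ℝ → En n → En n := fun u z => if u ≤ a then (Real.exp a : ℂ) • G (evolution n F (s + u) t z)
    else (Real.exp a : ℂ) • Gc (u - a) z with hH
  have hH1 : ∀ u, u ≤ a → H u = fun z => (Real.exp a : ℂ) • G (evolution n F (s + u) t z) := by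
    intro u hu
    funext z
    exact if_pos hu
  have hH2 : ∀ u, a ≤ u → EqOn (H u) (fun z => (Real.exp a : ℂ) • Gc (u - a) z) (Ball n) := by
    intro u hu z hz
    rcases hu.eq_or_lt with h | h
    · rw [hH1 u h.ge, ← h]
      have h1 : evolution n F (s + a) t z = z := by
        have h2 : s + a = t := by rw [ha]; ring
        rw [h2]
        exact (hF.1.1 t ht).2.leftInvOn_invFunOn hz
      simp only [h1, sub_self, hG0]
    · exact if_neg (not_lt.2 h.le |> fun _ => not_le.2 h)
  have hsu : ∀ u, 0 ≤ u → 0 ≤ s + u := fun u hu => by linarith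
  have hut : ∀ u, u ≤ a → s + u ≤ t := fun u hu => by rw [ha] at hu; linarith
  have hua : ∀ u, a ≤ u → 0 ≤ u - a := fun u hu => by linarith
  -- univalence
  have huniv : ∀ u, 0 ≤ u → UnivalentOn n (H u) := by
    intro u hu
    rcases le_total u a with h | h
    · rw [hH1 u h]
      have hm : MapsTo (evolution n F (s + u) t) (Ball n) (Ball n) :=
        fun z hz => evol_mem hF (hsu u hu) (hut u h) hz
      refine ⟨?_, ?_⟩
      · exact (hGS.1.1.comp (evol_diff hF (hsu u hu) (hut u h)) hm).const_smul (Real.exp a : ℂ)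
      · intro x hx y hy hxy
        have h1 := smul_right_injective (En n) hea hxy
        exact evol_inj hF (hsu u hu) (hut u h) hx hy (hGS.1.2 (hm hx) (hm hy) h1)
    · have hu' := hGc.1.1 (u - a) (hua u h)
      refine ⟨(hu'.1.const_smul (Real.exp a : ℂ)).congr (hH2 u h), ?_⟩
      intro x hx y hy hxy
      rw [hH2 u h hx, hH2 u h hy] at hxy
      exact hu'.2 hx hy (smul_right_injective (En n) hea hxy)
  -- normalization
  have hnorm : ∀ u, 0 ≤ u → H u 0 = 0 ∧
      fderiv ℂ (H u) 0 = (Real.exp u : ℂ) • ContinuousLinearMap.id ℂ (En n) := by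
    intro u hu
    rcases le_total u a with h | h
    · have hz := evol_zero hF (hsu u hu) (hut u h)
      rw [hH1 u h]
      refine ⟨by simp only [hz, hGS.2.1, smul_zero], ?_⟩
      have h1 := evol_hasFDeriv hF (hsu u hu) (hut u h)
      have h2 : HasFDerivAt G (ContinuousLinearMap.id ℂ (En n)) (evolution n F (s + u) t 0) := by
        rw [hz, ← hGS.2.2]
        exact (hGS.1.1.differentiableAt (hB.mem_nhds (zero_mem_Ball n))).hasFDerivAt
      have h3 := ((h2.comp 0 h1).const_smul (Real.exp a : ℂ)).fderiv
      refine Eq.trans h3 ?_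
      rw [ContinuousLinearMap.id_comp, smul_smul, ← Complex.ofReal_mul, ← Real.exp_add]
      congr 3
      rw [ha]; ring
    · have h0 := hGc.2 (u - a) (hua u h)
      refine ⟨by rw [hH2 u h (zero_mem_Ball n)]; simp only [h0.1, smul_zero], ?_⟩
      have h1 : H u =ᶠ[nhds 0] fun z => (Real.exp a : ℂ) • Gc (u - a) z := by
        filter_upwards [hB.mem_nhds (zero_mem_Ball n)] with z hz using hH2 u h hz
      have h2 := ((hGc.1.1 (u - a) (hua u h)).1.differentiableAt
        (hB.mem_nhds (zero_mem_Ball n))).hasFDerivAt.const_smul (Real.exp a : ℂ)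
      rw [h1.fderiv_eq]
      refine Eq.trans h2.fderiv ?_
      rw [h0.2, smul_smul, ← Complex.ofReal_mul, ← Real.exp_add]
      congr 3
      ring
  -- monotonicity
  have himg1 : ∀ u, 0 ≤ u → u ≤ a → ∀ v, u ≤ v → v ≤ a → H u '' Ball n ⊆ H v '' Ball n := by
    intro u hu hua' v huv hva
    rintro _ ⟨z, hz, rfl⟩
    obtain ⟨y, hy, hyz⟩ := hF.1.2.1 (s + u) (s + v) (hsu u hu) (by linarith)
      (mem_image_of_mem _ hz)
    refine ⟨y, hy, ?_⟩
    rw [hH1 u hua', hH1 v hva]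
    simp only [evolution, hyz]
  have himg2 : ∀ u, a ≤ u → ∀ v, u ≤ v → H u '' Ball n ⊆ H v '' Ball n := by
    intro u hau v huv
    rintro _ ⟨z, hz, rfl⟩
    obtain ⟨y, hy, hyz⟩ := hGc.1.2.1 (u - a) (v - a) (hua u hau) (by linarith)
      (mem_image_of_mem _ hz)
    refine ⟨y, hy, ?_⟩
    rw [hH2 u hau hz, hH2 v (hau.trans huv) hy]
    simp only [hyz]
  have himg : ∀ u v, 0 ≤ u → u ≤ v → H u '' Ball n ⊆ H v '' Ball n := by
    intro u v hu huv
    rcases le_total u a with h | h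
    · rcases le_total v a with h' | h'
      · exact himg1 u hu h v huv h'
      · exact (himg1 u hu h a h le_rfl).trans (himg2 a le_rfl v h')
    · exact himg2 u h v huv
  -- absolute continuity
  have hac : ∀ K : Set (En n), K ⊆ Ball n → IsCompact K → ∀ T : ℝ, 0 < T →
      ∃ c : ℝ → ℝ, (∀ τ, 0 ≤ c τ) ∧ IntegrableOn c (Set.Icc 0 T) ∧
      ∀ z ∈ K, ∀ s t : ℝ, 0 ≤ s → s ≤ t → t ≤ T →
        ‖H s z - H t z‖ ≤ ∫ τ in Set.Icc s t, c τ := by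
    intro K hK hKc T hT
    obtain ⟨r, hr1, hr⟩ := compact_sub hK hKc
    have hrB : closedBall (0 : En n) r ⊆ Ball n := closedBall_subset_ball hr1
    set ψ := Function.invFunOn (F t) (Ball n) with hψ
    set Q : En n → En n := fun w => (Real.exp a : ℂ) • G (ψ w) with hQ
    have hQlip : ∃ L, LipschitzOnWith L Q (F t '' closedBall 0 r) := by
      refine LocallyLipschitzOn.exists_lipschitzOnWith_of_compact
        ((isCompact_closedBall 0 r).image_of_continuousOn
          ((hF.1.1 t ht).1.continuousOn.mono hrB)) ?_
      rintro _ ⟨z, hz, rfl⟩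
      obtain ⟨e, -, he⟩ := inv_facts (hF.1.1 t ht) (c := (Real.exp t : ℂ))
        (by exact_mod_cast (Real.exp_pos t).ne') (hF.2 t ht).2 (hrB hz)
      have hψz : ψ (F t z) = z := (hF.1.1 t ht).2.leftInvOn_invFunOn (hrB hz)
      have hGz := strict_of_diff hB hGS.1.1 (hrB hz)
      rw [← hψz] at hGz
      have hQs := (HasStrictFDerivAt.comp (F t z) hGz he).const_smul (Real.exp a : ℂ)
      obtain ⟨L, N, hN, hL⟩ := hQs.exists_lipschitzOnWith
      exact ⟨L, N, mem_nhdsWithin_of_mem_nhds hN, hL⟩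
    obtain ⟨L, hL⟩ := hQlip
    obtain ⟨c1, hc1, hc1i, hc1b⟩ := hF.1.2.2 K hK hKc (t + 1) (by linarith)
    obtain ⟨c2, hc2, hc2i, hc2b⟩ := hGc.1.2.2 K hK hKc T hT
    set d1 : ℝ → ℝ := fun τ => L * (Icc 0 (t + 1)).indicator c1 (τ + s) with hd1
    set d2 : ℝ → ℝ := fun τ => Real.exp a * (Icc 0 T).indicator c2 (τ + -a) with hd2
    have hd1n : ∀ τ, 0 ≤ d1 τ := fun τ =>
      mul_nonneg L.2 (indicator_nonneg (fun x _ => hc1 x) _)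
    have hd2n : ∀ τ, 0 ≤ d2 τ := fun τ =>
      mul_nonneg (Real.exp_pos a).le (indicator_nonneg (fun x _ => hc2 x) _)
    have hd1i : Integrable d1 :=
      (((integrable_indicator_iff measurableSet_Icc).2 hc1i).comp_add_right s).const_mul _
    have hd2i : Integrable d2 :=
      (((integrable_indicator_iff measurableSet_Icc).2 hc2i).comp_add_right (-a)).const_mul _
    have hb1 : ∀ z ∈ K, ∀ u v, 0 ≤ u → u ≤ v → v ≤ a →
        ‖H u z - H v z‖ ≤ ∫ τ in Icc u v, d1 τ := by
      intro z hz u v hu huv hva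
      have hmem : ∀ x, 0 ≤ x → x ≤ a → F (s + x) z ∈ F t '' closedBall 0 r := by
        intro x hx hxa
        refine ⟨evolution n F (s + x) t z, ?_, evol_eq hF (hsu x hx) (hut x hxa) (hK hz)⟩
        rw [mem_closedBall_zero_iff]
        exact (evol_norm hF (hsu x hx) (hut x hxa) (hK hz)).trans (hr z hz)
      have h1 : ‖H u z - H v z‖ ≤ L * ‖F (s + u) z - F (s + v) z‖ := by
        rw [hH1 u (huv.trans hva), hH1 v hva]
        exact hL.norm_sub_le (hmem u hu (huv.trans hva)) (hmem v (hu.trans huv) hva)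
      have h2 := hc1b z (hz) (s + u) (s + v) (hsu u hu) (by linarith)
        (by linarith [hut v hva])
      rw [hd1, integral_const_mul, shift_int _ u v s huv,
        indicator_int _ _ _ _ (by linarith) (by linarith [hut v hva]), add_comm u s, add_comm v s]
      exact h1.trans (mul_le_mul_of_nonneg_left h2 L.2)
    have hb2 : ∀ z ∈ K, ∀ u v, a ≤ u → u ≤ v → v ≤ T →
        ‖H u z - H v z‖ ≤ ∫ τ in Icc u v, d2 τ := by
      intro z hz u v hau huv hvT
      rw [hH2 u hau (hK hz), hH2 v (hau.trans huv) (hK hz)]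
      have h2 := hc2b z hz (u - a) (v - a) (hua u hau) (by linarith) (by linarith)
      rw [hd2, integral_const_mul, shift_int _ u v (-a) huv,
        indicator_int _ _ _ _ (by linarith) (by linarith), ← sub_eq_add_neg, ← sub_eq_add_neg]
      simp only []
      rw [← smul_sub, norm_smul, hnea]
      exact mul_le_mul_of_nonneg_left h2 (Real.exp_pos a).le
    refine ⟨fun τ => d1 τ + d2 τ, fun τ => add_nonneg (hd1n τ) (hd2n τ),
      (hd1i.add hd2i).integrableOn, ?_⟩
    intro z hz u v hu huv hvT
    rw [integral_add hd1i.integrableOn hd2i.integrableOn]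
    have hn1 : 0 ≤ ∫ τ in Icc u v, d1 τ := integral_nonneg hd1n
    have hn2 : 0 ≤ ∫ τ in Icc u v, d2 τ := integral_nonneg hd2n
    rcases le_total u a with h | h
    · rcases le_total v a with h' | h'
      · linarith [hb1 z hz u v hu huv h']
      · have e1 := hb1 z hz u a hu h le_rfl
        have e2 := hb2 z hz a v le_rfl h' hvT
        have e3 : ∫ τ in Icc u a, d1 τ ≤ ∫ τ in Icc u v, d1 τ :=
          setIntegral_mono_set hd1i.integrableOn (Eventually.of_forall hd1n)
            (Icc_subset_Icc le_rfl h').eventuallyLE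
        have e4 : ∫ τ in Icc a v, d2 τ ≤ ∫ τ in Icc u v, d2 τ :=
          setIntegral_mono_set hd2i.integrableOn (Eventually.of_forall hd2n)
            (Icc_subset_Icc h le_rfl).eventuallyLE
        have e5 := norm_sub_le_norm_sub_add_norm_sub (H u z) (H a z) (H v z)
        linarith
    · linarith [hb2 z hz u v h huv hvT]
  -- normality
  have hnormal : IsNormalFamilyChain n H := by
    intro K hK hKc
    obtain ⟨r, hr1, hr⟩ := compact_sub hK hKc
    have hrB : closedBall (0 : En n) r ⊆ Ball n := closedBall_subset_ball hr1
    obtain ⟨M1, hM1⟩ := (isCompact_closedBall (0 : En n) r).exists_bound_of_continuousOn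
      (hGS.1.1.continuousOn.mono hrB)
    obtain ⟨M2, hM2⟩ := hGN K hK hKc
    refine ⟨max (Real.exp a * M1) M2, fun u hu z hz => ?_⟩
    rcases le_total u a with h | h
    · refine le_trans ?_ (le_max_left _ _)
      rw [hH1 u h]
      simp only [norm_smul, hnea]
      have h1 := hM1 (evolution n F (s + u) t z) (by
        rw [mem_closedBall_zero_iff]
        exact (evol_norm hF (hsu u hu) (hut u h) (hK hz)).trans (hr z hz))
      have h2 : Real.exp (-u) ≤ 1 := Real.exp_le_one_iff.2 (by linarith)
      calc _ ≤ 1 * (Real.exp a * ‖G (evolution n F (s + u) t z)‖) := by gcongr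
        _ ≤ Real.exp a * M1 := by rw [one_mul]; gcongr
    · refine le_trans ?_ (le_max_right _ _)
      rw [hH2 u h (hK hz)]
      simp only [norm_smul, hnea]
      have h1 := hM2 (u - a) (hua u h) z hz
      rwa [← mul_assoc, ← Real.exp_add, show -u + a = -(u - a) by ring]
  have hH0 : H 0 = fun z => (Real.exp a : ℂ) • G (evolution n F s t z) := by
    rw [hH1 0 ha0, add_zero]
  rw [← hH0]
  refine ⟨⟨huniv 0 le_rfl, (hnorm 0 le_rfl).1, ?_⟩, H, ⟨⟨huniv, himg, hac⟩, hnorm⟩, hnormal, rfl⟩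
  have := (hnorm 0 le_rfl).2
  rwa [Real.exp_zero, Complex.ofReal_one, one_smul] at this
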